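/- arXiv:2305.04057 — 3 statements merged into one kernel-verified Lean document; each statement's English description precedes it below -/
import Mathlib

section
/- Let (X,d) be a compact metric space, T : X → X a continuous map and f : X → ℝ continuous. Then the topological pressure with respect to the Feldman-Katok metric equals the classical topological pressure: PFK(X,T,f) = P(X,T,f). -/
open Filter Metric Set Topology

variable {X : Type*}

noncomputable def matchMax [MetricSpace X] (T : X → X) (n : ℕ) (δ : ℝ) (x y : X) : ℕ :=
  sSup { k : ℕ | ∃ a b : ℕ → ℕ,
      StrictMonoOn a (Set.Iio k) ∧ StrictMonoOn b (Set.Iio k) ∧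
      (∀ t < k, a t < n ∧ b t < n) ∧
      ∀ t < k, dist (T^[a t] x) (T^[b t] y) < δ }

noncomputable def fbar [MetricSpace X] (T : X → X) (n : ℕ) (δ : ℝ) (x y : X) : ℝ :=
  1 - (matchMax T n δ x y : ℝ) / n

noncomputable def dFK [MetricSpace X] (T : X → X) (n : ℕ) (x y : X) : ℝ :=
  sInf { δ : ℝ | 0 < δ ∧ fbar T n δ x y < δ }

noncomputable def FKsp [MetricSpace X] (T : X → X) (f : X → ℝ) (n : ℕ) (ε : ℝ) : ℝ :=
  sInf { r : ℝ | ∃ F : Finset X, (∀ x : X, ∃ y ∈ F, dFK T n x y ≤ ε) ∧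
      r = ∑ y ∈ F, Real.exp (∑ i ∈ Finset.range n, f (T^[i] y)) }

noncomputable def PFK [MetricSpace X] (T : X → X) (f : X → ℝ) : ℝ :=
  limsup (fun ε : ℝ => limsup (fun n : ℕ => Real.log (FKsp T f n ε) / n) atTop)
    (nhdsWithin 0 (Set.Ioi 0))

noncomputable def spanPress [MetricSpace X] (T : X → X) (f : X → ℝ) (n : ℕ) (ε : ℝ) : ℝ :=
  sInf { r : ℝ | ∃ F : Finset X,
      (∀ x : X, ∃ y ∈ F, ∀ i < n, dist (T^[i] x) (T^[i] y) ≤ ε) ∧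
      r = ∑ y ∈ F, Real.exp (∑ i ∈ Finset.range n, f (T^[i] y)) }

noncomputable def Pres [MetricSpace X] (T : X → X) (f : X → ℝ) : ℝ :=
  limsup (fun ε : ℝ => limsup (fun n : ℕ => Real.log (spanPress T f n ε) / n) atTop)
    (nhdsWithin 0 (Set.Ioi 0))

/-- The Birkhoff sum of `f` along the first `n` points of the orbit of `x`. -/
noncomputable def orbitSum (T : X → X) (f : X → ℝ) (n : ℕ) (x : X) : ℝ :=
  ∑ i ∈ Finset.range n, f (T^[i] x)

/-- The times at which a code is blank. -/
def blanks {α : Type*} [DecidableEq α] {n : ℕ} (c : Fin n → Option α) : Finset ℕ :=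
  (Finset.univ.filter fun i => c i = none).image Fin.val

/-- The order-preserving partner in `R` of a time in `D`. -/
noncomputable def partner (D R : Finset ℕ) (i : ℕ) : ℕ :=
  Nat.nth (· ∈ R) (Nat.count (· ∈ D) i)

lemma count_image_of_strictMonoOn {a : ℕ → ℕ} {k t : ℕ} (ha : StrictMonoOn a (Iio k))
    (ht : t < k) : Nat.count (· ∈ (Finset.range k).image a) (a t) = t := by
  have h : (Finset.range (a t)).filter (· ∈ (Finset.range k).image a)
      = (Finset.range t).image a := by
    ext j
    simp only [Finset.mem_filter, Finset.mem_range, Finset.mem_image]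
    constructor
    · rintro ⟨h1, s, hs, rfl⟩
      exact ⟨s, (ha.lt_iff_lt hs ht).1 h1, rfl⟩
    · rintro ⟨s, hs, rfl⟩
      exact ⟨ha (hs.trans ht) ht hs, s, hs.trans ht, rfl⟩
  rw [Nat.count_eq_card_filter_range, h, Finset.card_image_of_injOn, Finset.card_range]
  intro s hs u hu hsu
  simp only [Finset.coe_range, mem_Iio] at hs hu
  exact ha.injOn (hs.trans ht) (hu.trans ht) hsu

lemma partner_image {a b : ℕ → ℕ} {k t : ℕ} (ha : StrictMonoOn a (Iio k))
    (hb : StrictMonoOn b (Iio k)) (ht : t < k) :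
    partner ((Finset.range k).image a) ((Finset.range k).image b) (a t) = b t := by
  rw [partner, count_image_of_strictMonoOn ha ht]
  conv_lhs => rw [← count_image_of_strictMonoOn hb ht]
  exact Nat.nth_count (p := (· ∈ (Finset.range k).image b))
    (Finset.mem_image_of_mem b (Finset.mem_range.2 ht))

lemma card_codes_le {α : Type*} [Fintype α] [DecidableEq α] (n : ℕ) {s L : ℝ} (hL : 0 ≤ L) :
    ((Finset.univ.filter fun c : Fin n → Option α =>
        ((Finset.univ.filter fun i => c i ≠ none).card : ℝ) ≤ s * n).card : ℝ)
      ≤ Real.exp (n * (L * s + Fintype.card α * Real.exp (-L))) := by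
  set A := Finset.univ.filter fun c : Fin n → Option α =>
        ((Finset.univ.filter fun i => c i ≠ none).card : ℝ) ≤ s * n
  let w : Option α → ℝ := fun o => if o ≠ none then Real.exp (-L) else 1
  have hw : ∀ c : Fin n → Option α, ∏ i, w (c i)
      = Real.exp (-L) ^ (Finset.univ.filter fun i => c i ≠ none).card := by
    intro c
    rw [Finset.prod_ite]
    simp
  have hsum : ∑ c : Fin n → Option α, ∏ i, w (c i)
      = (1 + Fintype.card α * Real.exp (-L)) ^ n := by
    have h := Finset.prod_univ_sum (fun _ : Fin n => (Finset.univ : Finset (Option α)))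
      (fun _ o => w o)
    rw [Fintype.piFinset_univ] at h
    rw [← h]
    simp [w, Fintype.sum_option]
  have hlow : (A.card : ℝ) * Real.exp (-(L * (s * n))) ≤ ∑ c : Fin n → Option α, ∏ i, w (c i) := by
    rw [← nsmul_eq_mul, ← Finset.sum_const]
    refine (Finset.sum_le_sum fun c hc => ?_).trans
      (Finset.sum_le_sum_of_subset_of_nonneg (Finset.subset_univ A) fun c _ _ => ?_)
    · rw [hw, ← Real.exp_nat_mul]
      have := (Finset.mem_filter.1 hc).2
      apply Real.exp_le_exp.2
      nlinarith
    · rw [hw]; positivity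
  have hup : (1 + Fintype.card α * Real.exp (-L)) ^ n
      ≤ Real.exp (n * (Fintype.card α * Real.exp (-L))) := by
    rw [Real.exp_nat_mul]
    refine pow_le_pow_left₀ (by positivity) ?_ n
    rw [add_comm]
    exact Real.add_one_le_exp _
  have h := hlow.trans (hsum.le.trans hup)
  rw [Real.exp_neg, ← div_eq_mul_inv, div_le_iff₀ (Real.exp_pos _), ← Real.exp_add] at h
  exact h.trans (Real.exp_le_exp.2 (by linarith))

lemma bddBelow_weights (T : X → X) (f : X → ℝ) (n : ℕ) (p : Finset X → Prop) :
    BddBelow { r : ℝ | ∃ F : Finset X, p F ∧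
      r = ∑ y ∈ F, Real.exp (∑ i ∈ Finset.range n, f (T^[i] y)) } :=
  ⟨0, by rintro r ⟨F, -, rfl⟩; positivity⟩

lemma exp_le_sum_weights {T : X → X} {f : X → ℝ} {n : ℕ} {B : ℝ}
    (hB : ∀ u, |f u| ≤ B) {F : Finset X} (hF : F.Nonempty) :
    Real.exp (n * -B) ≤ ∑ y ∈ F, Real.exp (orbitSum T f n y) := by
  obtain ⟨y, hy⟩ := hF
  refine le_trans ?_ (Finset.single_le_sum (f := fun y => Real.exp (orbitSum T f n y))
    (fun _ _ => (Real.exp_pos _).le) hy)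
  refine Real.exp_le_exp.2 ?_
  have := Finset.card_nsmul_le_sum (Finset.range n) (fun i => f (T^[i] y)) (-B)
      fun i _ => (abs_le.1 (hB _)).1
  simpa [orbitSum] using this

section Covering

variable [MetricSpace X]

lemma exists_spanning_of_cells {T : X → X} {f : X → ℝ} {n : ℕ} {ε : ℝ} {ι : Type*}
    (I : Finset ι) (S : ι → Set X) (w : ι → ℝ) (hcov : ∀ x, ∃ j ∈ I, x ∈ S j)
    (hdiam : ∀ j ∈ I, ∀ x ∈ S j, ∀ x' ∈ S j, ∀ i < n, dist (T^[i] x) (T^[i] x') ≤ ε)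
    (hw0 : ∀ j ∈ I, 0 ≤ w j) (hw : ∀ j ∈ I, ∀ x ∈ S j, Real.exp (orbitSum T f n x) ≤ w j) :
    ∃ F : Finset X, (∀ x : X, ∃ y ∈ F, ∀ i < n, dist (T^[i] x) (T^[i] y) ≤ ε) ∧
      ∑ y ∈ F, Real.exp (orbitSum T f n y) ≤ ∑ j ∈ I, w j := by
  classical
  rcases isEmpty_or_nonempty X with hX | hX
  · exact ⟨∅, fun x => isEmptyElim x, by simpa using Finset.sum_nonneg hw0⟩
  have hz : ∀ j, ∃ z, (S j).Nonempty → z ∈ S j := fun j => by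
    by_cases h : (S j).Nonempty
    · exact ⟨h.some, fun _ => h.some_mem⟩
    · exact ⟨hX.some, fun h' => absurd h' h⟩
  choose z hz using hz
  refine ⟨(I.filter fun j => (S j).Nonempty).image z, fun x => ?_, ?_⟩
  · obtain ⟨j, hj, hx⟩ := hcov x
    exact ⟨z j, Finset.mem_image_of_mem z (Finset.mem_filter.2 ⟨hj, x, hx⟩),
      hdiam j hj x hx _ (hz j ⟨x, hx⟩)⟩
  · calc _ ≤ ∑ j ∈ I with (S j).Nonempty, Real.exp (orbitSum T f n (z j)) :=
          Finset.sum_image_le_of_nonneg (f := fun y => Real.exp (orbitSum T f n y))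
            fun _ _ => (Real.exp_pos _).le
      _ ≤ ∑ j ∈ I with (S j).Nonempty, w j := by
          refine Finset.sum_le_sum fun j hj => ?_
          obtain ⟨hj, hne⟩ := Finset.mem_filter.1 hj
          exact hw j hj _ (hz j hne)
      _ ≤ _ := Finset.sum_le_sum_of_subset_of_nonneg (Finset.filter_subset _ _)
          fun j hj _ => hw0 j hj

lemma exists_match_of_dFK_lt {T : X → X} {n : ℕ} (hn : 0 < n) {s : ℝ} {x y : X}
    (h : dFK T n x y < s) : ∃ (k : ℕ) (a b : ℕ → ℕ),
      StrictMonoOn a (Iio k) ∧ StrictMonoOn b (Iio k) ∧ (∀ t < k, a t < n ∧ b t < n) ∧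
      (∀ t < k, dist (T^[a t] x) (T^[b t] y) < s) ∧ (n : ℝ) - k ≤ s * n := by
  have hn' : (0 : ℝ) < n := by exact_mod_cast hn
  have hne : { δ : ℝ | 0 < δ ∧ fbar T n δ x y < δ }.Nonempty := by
    refine ⟨2, by norm_num, ?_⟩
    have : (0 : ℝ) ≤ (matchMax T n 2 x y : ℝ) / n := by positivity
    rw [fbar]; linarith
  obtain ⟨δ, ⟨-, hδ⟩, hδs⟩ := exists_lt_of_csInf_lt hne h
  have hmem : matchMax T n δ x y ∈ { k : ℕ | ∃ a b : ℕ → ℕ,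
      StrictMonoOn a (Set.Iio k) ∧ StrictMonoOn b (Set.Iio k) ∧
      (∀ t < k, a t < n ∧ b t < n) ∧
      ∀ t < k, dist (T^[a t] x) (T^[b t] y) < δ } := by
    refine Nat.sSup_mem ⟨0, id, id, by simp [StrictMonoOn], by simp [StrictMonoOn],
      by simp, by simp⟩ ⟨n, ?_⟩
    rintro k ⟨a, b, ha, -, hab, -⟩
    have hc := Finset.card_le_card_of_injOn (s := Finset.range k) (t := Finset.range n) a
      (fun t ht => by
        simp only [Finset.coe_range, mem_Iio] at ht ⊢
        exact (hab t ht).1)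
      (by simpa using ha.injOn)
    simpa using hc
  obtain ⟨a, b, ha, hb, hab, hd⟩ := hmem
  refine ⟨_, a, b, ha, hb, hab, fun t ht => (hd t ht).trans hδs, ?_⟩
  rw [fbar] at hδ
  have h2 : 1 - s ≤ (matchMax T n δ x y : ℝ) / n := by linarith
  rw [le_div_iff₀ hn'] at h2
  linarith

lemma dFK_le_of_forall_dist_le {T : X → X} {n : ℕ} (hn : 0 < n) {ε : ℝ} (hε : 0 < ε) {x y : X}
    (h : ∀ i < n, dist (T^[i] x) (T^[i] y) ≤ ε) : dFK T n x y ≤ ε := by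
  refine le_of_forall_pos_le_add fun η hη => csInf_le ⟨0, fun δ hδ => hδ.1.le⟩ ⟨by linarith, ?_⟩
  have hle : n ≤ matchMax T n (ε + η) x y := by
    refine le_csSup ⟨n, ?_⟩ ⟨id, id, strictMonoOn_id, strictMonoOn_id, fun t ht => ⟨ht, ht⟩,
      fun t ht => (h t ht).trans_lt (by linarith)⟩
    rintro k ⟨a, b, ha, -, hab, -⟩
    have hc := Finset.card_le_card_of_injOn (s := Finset.range k) (t := Finset.range n) a
      (fun t ht => by
        simp only [Finset.coe_range, mem_Iio] at ht ⊢
        exact (hab t ht).1)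
      (by simpa using ha.injOn)
    simpa using hc
  have hn' : (0 : ℝ) < n := by exact_mod_cast hn
  have : 1 ≤ (matchMax T n (ε + η) x y : ℝ) / n := by
    rw [le_div_iff₀ hn', one_mul]; exact_mod_cast hle
  rw [fbar]; linarith

lemma orbitSum_le_of_match {T : X → X} {f : X → ℝ} {n k : ℕ} {s κ B : ℝ} {x y : X} {a b : ℕ → ℕ}
    (hB : ∀ u, |f u| ≤ B) (hκ : ∀ u v, dist u v < s → |f u - f v| ≤ κ) (hκ0 : 0 ≤ κ)
    (ha : StrictMonoOn a (Iio k)) (hb : StrictMonoOn b (Iio k))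
    (hab : ∀ t < k, a t < n ∧ b t < n) (hd : ∀ t < k, dist (T^[a t] x) (T^[b t] y) < s)
    (hk : (n : ℝ) - k ≤ s * n) :
    orbitSum T f n x ≤ orbitSum T f n y + n * (κ + 2 * s * B) := by
  have split : ∀ (c : ℕ → ℕ) (u : X), StrictMonoOn c (Iio k) → (∀ t < k, c t < n) →
      k ≤ n ∧ |orbitSum T f n u - ∑ t ∈ Finset.range k, f (T^[c t] u)| ≤ ((n : ℝ) - k) * B := by
    intro c u hc hcn
    have hsub : (Finset.range k).image c ⊆ Finset.range n := by
      intro j hj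
      obtain ⟨t, ht, rfl⟩ := Finset.mem_image.1 hj
      exact Finset.mem_range.2 (hcn t (Finset.mem_range.1 ht))
    have hinj : Set.InjOn c (Finset.range k) := by simpa using hc.injOn
    have hcard : ((Finset.range k).image c).card = k := by
      rw [Finset.card_image_of_injOn hinj, Finset.card_range]
    have hkn : k ≤ n := by simpa [hcard] using Finset.card_le_card hsub
    refine ⟨hkn, ?_⟩
    have e : orbitSum T f n u - ∑ t ∈ Finset.range k, f (T^[c t] u)
        = ∑ i ∈ Finset.range n \ (Finset.range k).image c, f (T^[i] u) := by
      rw [orbitSum, ← Finset.sum_sdiff hsub,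
        Finset.sum_image (f := fun i => f (T^[i] u)) hinj, add_sub_cancel_right]
    rw [e]
    refine (Finset.abs_sum_le_sum_abs _ _).trans
      ((Finset.sum_le_card_nsmul _ _ B fun i _ => hB _).trans ?_)
    rw [Finset.card_sdiff_of_subset hsub, hcard, Finset.card_range, nsmul_eq_mul,
      Nat.cast_sub hkn]
  obtain ⟨hkn, h1⟩ := split a x ha fun t ht => (hab t ht).1
  obtain ⟨-, h2⟩ := split b y hb fun t ht => (hab t ht).2
  have h3 : ∑ t ∈ Finset.range k, f (T^[a t] x)
      ≤ ∑ t ∈ Finset.range k, f (T^[b t] y) + k * κ := by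
    have : ∑ t ∈ Finset.range k, f (T^[a t] x)
        ≤ ∑ t ∈ Finset.range k, (f (T^[b t] y) + κ) := by
      refine Finset.sum_le_sum fun t ht => ?_
      have := (abs_le.1 (hκ _ _ (hd t (Finset.mem_range.1 ht)))).2
      linarith
    simpa [Finset.sum_add_distrib] using this
  have hB0 : 0 ≤ B := (abs_nonneg _).trans (hB x)
  have hkn' : (k : ℝ) ≤ n := by exact_mod_cast hkn
  have h4 := mul_le_mul_of_nonneg_right hk hB0
  have h5 := mul_le_mul_of_nonneg_right hkn' hκ0
  have h6 := (abs_le.1 h1).2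
  have h7 := (abs_le.1 h2).1
  nlinarith

lemma blanks_ite {α : Type*} [DecidableEq α] {n : ℕ} {D : Finset ℕ} (hD : D ⊆ Finset.range n)
    (g : Fin n → α) : blanks (fun i : Fin n => if (i : ℕ) ∈ D then none else some (g i)) = D := by
  ext j
  simp only [blanks, Finset.mem_image, Finset.mem_filter, Finset.mem_univ, true_and]
  constructor
  · rintro ⟨i, hi, rfl⟩
    by_contra h
    simp [h] at hi
  · intro hj
    exact ⟨⟨j, Finset.mem_range.1 (hD hj)⟩, by simp [hj], rfl⟩

lemma card_nonblank_ite {α : Type*} [DecidableEq α] {n : ℕ} {D : Finset ℕ}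
    (hD : D ⊆ Finset.range n) (g : Fin n → α) :
    ((Finset.univ.filter fun i : Fin n =>
      (if (i : ℕ) ∈ D then none else some (g i)) ≠ none).card : ℝ) = n - D.card := by
  have h := Finset.card_filter_add_card_filter_not (s := (Finset.univ : Finset (Fin n)))
    (fun i : Fin n => (if (i : ℕ) ∈ D then none else some (g i)) = none)
  have h2 : (Finset.univ.filter fun i : Fin n =>
      (if (i : ℕ) ∈ D then none else some (g i)) = none).card = D.card := by
    rw [← Finset.card_image_of_injective _ Fin.val_injective]
    exact congrArg Finset.card (blanks_ite hD g)
  rw [h2, Finset.card_univ, Fintype.card_fin] at h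
  rw [eq_sub_iff_add_eq']
  exact_mod_cast h

lemma exists_spanning_le_mul {T : X → X} {f : X → ℝ} {n : ℕ} (hn : 0 < n)
    {ε s κ B L : ℝ} (hL : 0 ≤ L) (hsε : 2 * s ≤ ε) (hB : ∀ u, |f u| ≤ B)
    (hκ : ∀ u v, dist u v < s → |f u - f v| ≤ κ) (hκ0 : 0 ≤ κ)
    {C : Finset X} (hC : ∀ u, ∃ c ∈ C, dist u c < ε / 2)
    {F : Finset X} (hF : ∀ x, ∃ y ∈ F, dFK T n x y < s) :
    ∃ F' : Finset X, (∀ x : X, ∃ y ∈ F', ∀ i < n, dist (T^[i] x) (T^[i] y) ≤ ε) ∧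
      ∑ y ∈ F', Real.exp (orbitSum T f n y)
        ≤ Real.exp (n * (2 * L * s + (C.card + 1) * Real.exp (-L) + κ + 2 * s * B))
          * ∑ y ∈ F, Real.exp (orbitSum T f n y) := by
  classical
  let A : Finset (Fin n → Option C) := Finset.univ.filter fun c =>
        ((Finset.univ.filter fun i => c i ≠ none).card : ℝ) ≤ s * n
  let R : Finset (Fin n → Option Unit) := Finset.univ.filter fun c =>
        ((Finset.univ.filter fun i => c i ≠ none).card : ℝ) ≤ s * n
  let S : X × (Fin n → Option C) × (Fin n → Option Unit) → Set X := fun j =>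
    { x | orbitSum T f n x ≤ orbitSum T f n j.1 + n * (κ + 2 * s * B) ∧
      (∀ i ∈ blanks j.2.1,
        dist (T^[i] x) (T^[partner (blanks j.2.1) (blanks j.2.2) i] j.1) < s) ∧
      ∀ i : Fin n, ∀ u : C, j.2.1 i = some u → dist (T^[i] x) u < ε / 2 }
  let w : X × (Fin n → Option C) × (Fin n → Option Unit) → ℝ := fun j =>
    Real.exp (n * (κ + 2 * s * B)) * Real.exp (orbitSum T f n j.1)
  have hcov : ∀ x, ∃ j ∈ F ×ˢ A ×ˢ R, x ∈ S j := by
    intro x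
    obtain ⟨y, hy, hxy⟩ := hF x
    obtain ⟨k, a, b, ha, hb, hab, hd, hk⟩ := exists_match_of_dFK_lt hn hxy
    choose g hgC hg using fun i : Fin n => hC (T^[i] x)
    have key : ∀ c : ℕ → ℕ, StrictMonoOn c (Iio k) → (∀ t < k, c t < n) →
        (Finset.range k).image c ⊆ Finset.range n ∧ ((Finset.range k).image c).card = k := by
      intro c hc hcn
      refine ⟨fun j hj => ?_, ?_⟩
      · obtain ⟨t, ht, rfl⟩ := Finset.mem_image.1 hj
        exact Finset.mem_range.2 (hcn t (Finset.mem_range.1 ht))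
      · rw [Finset.card_image_of_injOn (by simpa using hc.injOn), Finset.card_range]
    obtain ⟨hDn, hDk⟩ := key a ha fun t ht => (hab t ht).1
    obtain ⟨hRn, hRk⟩ := key b hb fun t ht => (hab t ht).2
    refine ⟨(y, fun i => if (i : ℕ) ∈ (Finset.range k).image a then none
        else some ⟨g i, hgC i⟩, fun i => if (i : ℕ) ∈ (Finset.range k).image b then none
        else some ()), ?_, ?_, ?_, ?_⟩
    · refine Finset.mk_mem_product hy (Finset.mk_mem_product ?_ ?_)
      · refine Finset.mem_filter.2 ⟨Finset.mem_univ _, ?_⟩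
        rw [card_nonblank_ite hDn, hDk]; exact hk
      · refine Finset.mem_filter.2 ⟨Finset.mem_univ _, ?_⟩
        rw [card_nonblank_ite hRn, hRk]; exact hk
    · exact orbitSum_le_of_match hB hκ hκ0 ha hb hab hd hk
    · simp only
      rw [blanks_ite hDn, blanks_ite hRn]
      intro i hi
      obtain ⟨t, ht, rfl⟩ := Finset.mem_image.1 hi
      rw [Finset.mem_range] at ht
      rw [partner_image ha hb ht]
      exact hd t ht
    · intro i u hu
      simp only at hu
      split_ifs at hu with h
      rw [← Option.some.inj hu]
      exact hg i
  have hdiam : ∀ j ∈ F ×ˢ A ×ˢ R, ∀ x ∈ S j, ∀ x' ∈ S j, ∀ i < n,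
      dist (T^[i] x) (T^[i] x') ≤ ε := by
    rintro ⟨y, c, r⟩ - x ⟨-, hx1, hx2⟩ x' ⟨-, hx1', hx2'⟩ i hi
    rcases hc : c ⟨i, hi⟩ with _ | u
    · have hib : i ∈ blanks c :=
        Finset.mem_image.2 ⟨⟨i, hi⟩, Finset.mem_filter.2 ⟨Finset.mem_univ _, hc⟩, rfl⟩
      have h1 := hx1 i hib
      have h2 := hx1' i hib
      have := dist_triangle_right (T^[i] x) (T^[i] x')
        (T^[partner (blanks c) (blanks r) i] y)
      simp only at h1 h2
      linarith
    · have h1 := hx2 ⟨i, hi⟩ u hc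
      have h2 := hx2' ⟨i, hi⟩ u hc
      have := dist_triangle_right (T^[i] x) (T^[i] x') (u : X)
      simp only at h1 h2
      linarith
  have hw : ∀ j ∈ F ×ˢ A ×ˢ R, ∀ x ∈ S j, Real.exp (orbitSum T f n x) ≤ w j := by
    rintro ⟨y, c, r⟩ - x ⟨hx, -⟩
    simp only [w]
    rw [← Real.exp_add]
    exact Real.exp_le_exp.2 (by linarith)
  obtain ⟨F', hF', hle⟩ := exists_spanning_of_cells (F ×ˢ A ×ˢ R) S w hcov hdiam
    (fun j _ => by positivity) hw
  refine ⟨F', hF', hle.trans ?_⟩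
  have hA := card_codes_le (α := C) n (s := s) hL
  have hR := card_codes_le (α := Unit) n (s := s) hL
  have e : ∑ j ∈ F ×ˢ A ×ˢ R, w j = (A.card * R.card : ℝ) * Real.exp (n * (κ + 2 * s * B))
      * ∑ y ∈ F, Real.exp (orbitSum T f n y) := by
    rw [Finset.sum_product, Finset.mul_sum]
    refine Finset.sum_congr rfl fun y _ => ?_
    simp only [w, Finset.sum_const, Finset.card_product, nsmul_eq_mul, Nat.cast_mul]
    ring
  rw [e]
  refine mul_le_mul_of_nonneg_right ?_ (by positivity)
  calc (A.card * R.card : ℝ) * Real.exp (n * (κ + 2 * s * B))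
      ≤ (Real.exp (n * (L * s + Fintype.card C * Real.exp (-L)))
        * Real.exp (n * (L * s + Fintype.card Unit * Real.exp (-L))))
        * Real.exp (n * (κ + 2 * s * B)) := by gcongr
    _ = _ := by
      rw [← Real.exp_add, ← Real.exp_add]
      congr 1
      simp only [Fintype.card_coe, Fintype.card_unit, Nat.cast_one]
      ring

lemma exists_spanning_sum_le {T : X → X} {f : X → ℝ} (n : ℕ) {ε B : ℝ} (hB : ∀ u, |f u| ≤ B)
    {C : Finset X} (hC : ∀ u, ∃ c ∈ C, dist u c < ε / 2) :
    ∃ F : Finset X, (∀ x : X, ∃ y ∈ F, ∀ i < n, dist (T^[i] x) (T^[i] y) ≤ ε) ∧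
      ∑ y ∈ F, Real.exp (orbitSum T f n y) ≤ Real.exp (n * (C.card + B)) := by
  classical
  let S : (Fin n → C) → Set X := fun g => {x | ∀ i : Fin n, dist (T^[i] x) (g i) < ε / 2}
  have hcov : ∀ x, ∃ g ∈ (Finset.univ : Finset (Fin n → C)), x ∈ S g := by
    intro x
    choose g hgC hg using fun i : Fin n => hC (T^[i] x)
    exact ⟨fun i => ⟨g i, hgC i⟩, Finset.mem_univ _, hg⟩
  have hdiam : ∀ g ∈ (Finset.univ : Finset (Fin n → C)), ∀ x ∈ S g, ∀ x' ∈ S g, ∀ i < n,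
      dist (T^[i] x) (T^[i] x') ≤ ε := by
    intro g _ x hx x' hx' i hi
    have h1 := hx ⟨i, hi⟩
    have h2 := hx' ⟨i, hi⟩
    have := dist_triangle_right (T^[i] x) (T^[i] x') (g ⟨i, hi⟩ : X)
    simp only at h1 h2
    linarith
  have hw : ∀ g ∈ (Finset.univ : Finset (Fin n → C)), ∀ x ∈ S g,
      Real.exp (orbitSum T f n x) ≤ Real.exp (n * B) := by
    intro _ _ x _
    refine Real.exp_le_exp.2 ?_
    have := Finset.sum_le_card_nsmul (Finset.range n) (fun i => f (T^[i] x)) B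
      fun i _ => (abs_le.1 (hB _)).2
    simpa [orbitSum] using this
  obtain ⟨F, hF, hle⟩ := exists_spanning_of_cells Finset.univ S (fun _ => Real.exp (n * B))
    hcov hdiam (fun _ _ => by positivity) hw
  refine ⟨F, hF, hle.trans ?_⟩
  simp only [Finset.sum_const, Finset.card_univ, Fintype.card_fun, Fintype.card_fin,
    Fintype.card_coe, nsmul_eq_mul, Nat.cast_pow]
  rw [mul_add, Real.exp_add]
  have := Real.add_one_le_exp (C.card : ℝ)
  exact mul_le_mul_of_nonneg_right
    (pow_le_pow_left₀ (by positivity) (by linarith) n |>.trans_eq (Real.exp_nat_mul _ n).symm)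
    (Real.exp_pos _).le

end Covering

section Compact

variable [MetricSpace X] [CompactSpace X]

lemma exists_finset_dist_lt {ε : ℝ} (hε : 0 < ε) : ∃ C : Finset X, ∀ u, ∃ c ∈ C, dist u c < ε := by
  obtain ⟨t, -, ht, hcov⟩ := finite_cover_balls_of_compact (isCompact_univ (X := X)) hε
  refine ⟨ht.toFinset, fun u => ?_⟩
  obtain ⟨c, hc, hu⟩ := mem_iUnion₂.1 (hcov (mem_univ u))
  exact ⟨c, ht.mem_toFinset.2 hc, hu⟩

lemma FKsp_le_spanPress (T : X → X) {f : X → ℝ} {B : ℝ} (hB : ∀ u, |f u| ≤ B) {n : ℕ}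
    (hn : 0 < n) {ε : ℝ} (hε : 0 < ε) : FKsp T f n ε ≤ spanPress T f n ε := by
  obtain ⟨C, hC⟩ := exists_finset_dist_lt (X := X) (half_pos hε)
  obtain ⟨F, hF, -⟩ := exists_spanning_sum_le (T := T) n hB hC
  refine csInf_le_csInf (bddBelow_weights T f n _) ⟨_, F, hF, rfl⟩ ?_
  rintro r ⟨F, hF, rfl⟩
  refine ⟨F, fun x => ?_, rfl⟩
  obtain ⟨y, hy, h⟩ := hF x
  exact ⟨y, hy, dFK_le_of_forall_dist_le hn hε h⟩

lemma exp_le_FKsp [Nonempty X] (T : X → X) {f : X → ℝ} {B : ℝ} (hB : ∀ u, |f u| ≤ B) {n : ℕ}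
    (hn : 0 < n) {ε : ℝ} (hε : 0 < ε) : Real.exp (n * -B) ≤ FKsp T f n ε := by
  obtain ⟨C, hC⟩ := exists_finset_dist_lt (X := X) (half_pos hε)
  obtain ⟨F, hF, -⟩ := exists_spanning_sum_le (T := T) n hB hC
  refine le_csInf ⟨_, F, fun x => ?_, rfl⟩ ?_
  · obtain ⟨y, hy, h⟩ := hF x
    exact ⟨y, hy, dFK_le_of_forall_dist_le hn hε h⟩
  · rintro r ⟨F, hF, rfl⟩
    obtain ⟨y, hy, -⟩ := hF (Classical.arbitrary X)
    exact exp_le_sum_weights hB ⟨y, hy⟩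

lemma exists_spanPress_le_exp (T : X → X) {f : X → ℝ} {B : ℝ} (hB : ∀ u, |f u| ≤ B)
    {ε : ℝ} (hε : 0 < ε) : ∃ K : ℝ, ∀ n, spanPress T f n ε ≤ Real.exp (n * K) := by
  obtain ⟨C, hC⟩ := exists_finset_dist_lt (X := X) (half_pos hε)
  refine ⟨C.card + B, fun n => ?_⟩
  obtain ⟨F, hF, hle⟩ := exists_spanning_sum_le (T := T) n hB hC
  exact (csInf_le (bddBelow_weights T f n _) ⟨F, hF, rfl⟩).trans hle

lemma eventually_spanPress_le_mul_FKsp (T : X → X) {f : X → ℝ} (hf : Continuous f) {B : ℝ}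
    (hB : ∀ u, |f u| ≤ B) {ε η : ℝ} (hε : 0 < ε) (hη : 0 < η) :
    ∀ᶠ δ in 𝓝[>] (0 : ℝ), ∀ n, 0 < n →
      spanPress T f n ε ≤ Real.exp (n * η) * FKsp T f n δ := by
  obtain ⟨C, hC⟩ := exists_finset_dist_lt (X := X) (half_pos hε)
  obtain ⟨L, hL0, hL⟩ : ∃ L : ℝ, 0 ≤ L ∧ (C.card + 1) * Real.exp (-L) < η / 4 := by
    have h : Tendsto (fun L : ℝ => (C.card + 1) * Real.exp (-L)) atTop (𝓝 ((C.card + 1) * 0)) :=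
      (Real.tendsto_exp_neg_atTop_nhds_zero).const_mul _
    rw [mul_zero] at h
    exact ((eventually_ge_atTop 0).and (h.eventually_lt_const (by positivity))).exists
  obtain ⟨ρ, hρ0, hρ⟩ := Metric.uniformContinuous_iff.1
    (CompactSpace.uniformContinuous_of_continuous hf) (η / 4) (by positivity)
  have small : ∀ (g : ℝ → ℝ) (c : ℝ), Continuous g → g 0 < c → ∀ᶠ δ in 𝓝[>] (0 : ℝ), g δ < c :=
    fun g c hg h => (hg.tendsto 0).mono_left nhdsWithin_le_nhds |>.eventually_lt_const h
  filter_upwards [self_mem_nhdsWithin,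
    small (fun δ => 2 * δ) ρ (by fun_prop) (by simpa using hρ0),
    small (fun δ => 2 * (2 * δ)) ε (by fun_prop) (by simpa using hε),
    small (fun δ => 2 * L * (2 * δ)) (η / 4) (by fun_prop) (by simpa using hη),
    small (fun δ => 2 * (2 * δ) * B) (η / 4) (by fun_prop) (by simpa using hη)]
    with δ hδ h1 h2 h3 h4 n hn
  replace hδ : 0 < δ := hδ
  rw [← div_le_iff₀' (Real.exp_pos _)]
  obtain ⟨F₀, hF₀, -⟩ := exists_spanning_sum_le (T := T) n hB
    (exists_finset_dist_lt (X := X) (half_pos hδ)).choose_spec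
  refine le_csInf ⟨_, F₀, fun x => ?_, rfl⟩ ?_
  · obtain ⟨y, hy, h⟩ := hF₀ x
    exact ⟨y, hy, dFK_le_of_forall_dist_le hn hδ h⟩
  · rintro r ⟨F, hF, rfl⟩
    rw [div_le_iff₀' (Real.exp_pos _)]
    obtain ⟨F', hF', hle⟩ := exists_spanning_le_mul (T := T) (f := f) hn (s := 2 * δ)
      (κ := η / 4) hL0 h2.le hB
      (fun u v huv => by
        have := hρ (huv.trans h1)
        rw [Real.dist_eq] at this
        exact this.le) (by positivity) hC (F := F)
      (fun x => by
        obtain ⟨y, hy, h⟩ := hF x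
        exact ⟨y, hy, h.trans_lt (by linarith)⟩)
    refine (csInf_le (bddBelow_weights T f n _) ⟨F', hF', rfl⟩).trans (hle.trans ?_)
    refine mul_le_mul_of_nonneg_right (Real.exp_le_exp.2 ?_) (by positivity)
    exact mul_le_mul_of_nonneg_left (by linarith) (Nat.cast_nonneg n)

end Compact

/-- the topological pressure with respect to the Feldman-Katok metric
equals the classical topological pressure. -/
theorem PFK_eq_pressure [MetricSpace X] [CompactSpace X] (T : X → X)
    (hT : Continuous T) (f : X → ℝ) (hf : Continuous f) :
    PFK T f = Pres T f := by
  rcases isEmpty_or_nonempty X with hX | hX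
  · have h : ∀ n ε, FKsp T f n ε = spanPress T f n ε := fun n ε => by
      simp [FKsp, spanPress]
    simp only [PFK, Pres, h]
  obtain ⟨B, hB⟩ : ∃ B, ∀ u, |f u| ≤ B := by
    obtain ⟨B, hB⟩ := isCompact_univ.exists_bound_of_continuousOn hf.continuousOn
    exact ⟨B, fun u => hB u (mem_univ u)⟩
  have hFKpos : ∀ {n : ℕ} {ε : ℝ}, 0 < n → 0 < ε → 0 < FKsp T f n ε := fun hn hε =>
    (Real.exp_pos _).trans_le (exp_le_FKsp T hB hn hε)
  have hle : ∀ {n : ℕ} {ε : ℝ}, 0 < n → 0 < ε →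
      Real.log (FKsp T f n ε) / n ≤ Real.log (spanPress T f n ε) / n := fun hn hε =>
    div_le_div_of_nonneg_right
      (Real.log_le_log (hFKpos hn hε) (FKsp_le_spanPress T hB hn hε)) (Nat.cast_nonneg _)
  have hlow : ∀ {n : ℕ} {ε : ℝ}, 0 < n → 0 < ε → -B ≤ Real.log (FKsp T f n ε) / n := by
    intro n ε hn hε
    rw [le_div_iff₀' (by exact_mod_cast hn), Real.le_log_iff_exp_le (hFKpos hn hε)]
    exact exp_le_FKsp T hB hn hε
  have hup : ∀ {ε : ℝ}, 0 < ε → ∃ K, ∀ n : ℕ, 0 < n → Real.log (spanPress T f n ε) / n ≤ K := by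
    intro ε hε
    obtain ⟨K, hK⟩ := exists_spanPress_le_exp T hB hε
    refine ⟨K, fun n hn => ?_⟩
    rw [div_le_iff₀' (by exact_mod_cast hn),
      Real.log_le_iff_le_exp ((hFKpos hn hε).trans_le (FKsp_le_spanPress T hB hn hε))]
    exact hK n
  have hbddS : ∀ {ε : ℝ}, 0 < ε →
      IsBoundedUnder (· ≤ ·) atTop fun n : ℕ => Real.log (spanPress T f n ε) / n := by
    intro ε hε
    obtain ⟨K, hK⟩ := hup hε
    exact ⟨K, eventually_map.2 ((eventually_gt_atTop 0).mono hK)⟩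
  have hbddF : ∀ {ε : ℝ}, 0 < ε →
      IsBoundedUnder (· ≤ ·) atTop fun n : ℕ => Real.log (FKsp T f n ε) / n := fun hε =>
    (hbddS hε).mono_le ((eventually_gt_atTop 0).mono fun n hn => hle hn hε)
  have hcobF : ∀ {ε : ℝ}, 0 < ε →
      IsCoboundedUnder (· ≤ ·) atTop fun n : ℕ => Real.log (FKsp T f n ε) / n := fun hε =>
    IsBoundedUnder.isCoboundedUnder_le
      ⟨-B, eventually_map.2 ((eventually_gt_atTop 0).mono fun n hn => hlow hn hε)⟩
  have hcobS : ∀ {ε : ℝ}, 0 < ε →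
      IsCoboundedUnder (· ≤ ·) atTop fun n : ℕ => Real.log (spanPress T f n ε) / n := fun hε =>
    IsBoundedUnder.isCoboundedUnder_le
      ⟨-B, eventually_map.2 ((eventually_gt_atTop 0).mono fun n hn =>
        (hlow hn hε).trans (hle hn hε))⟩
  rw [PFK, Pres, limsup_eq, limsup_eq]
  congr 1
  ext c
  constructor
  · intro hc
    have hall : ∀ ε : ℝ, 0 < ε →
        limsup (fun n : ℕ => Real.log (spanPress T f n ε) / n) atTop ≤ c := by
      intro ε hε
      refine le_of_forall_pos_le_add fun η hη => ?_
      obtain ⟨δ, hδ, hδ0, hδc⟩ := ((eventually_spanPress_le_mul_FKsp T hf hB hε hη).and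
        ((eventually_mem_nhdsWithin (a := (0 : ℝ)) (s := Ioi 0)).and hc)).exists
      replace hδ0 : 0 < δ := hδ0
      refine le_trans ?_ (add_le_add_left hδc η)
      rw [← limsup_add_const atTop _ η (hbddF hδ0) (hcobF hδ0)]
      refine limsup_le_limsup ?_ (hcobS hε) ?_
      · filter_upwards [eventually_gt_atTop 0] with n hn
        have hn' : (0 : ℝ) < n := by exact_mod_cast hn
        have h := Real.log_le_log ((hFKpos hn hε).trans_le (FKsp_le_spanPress T hB hn hε))
          (hδ n hn)
        rw [Real.log_mul (Real.exp_pos _).ne' (hFKpos hn hδ0).ne', Real.log_exp] at h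
        rw [div_le_iff₀ hn', add_mul, div_mul_cancel₀ _ hn'.ne']
        linarith
      · obtain ⟨K, hK⟩ := (hbddF hδ0)
        exact ⟨K + η, eventually_map.2 ((eventually_map.1 hK).mono fun n hn =>
          add_le_add_left hn η)⟩
    exact eventually_nhdsWithin_of_forall hall
  · intro hc
    filter_upwards [hc, self_mem_nhdsWithin] with ε h hε
    exact (limsup_le_limsup ((eventually_gt_atTop 0).mono fun n hn => hle hn hε)
      (hcobF hε) (hbddS hε)).trans h
end

section
/- Let (X,d) be a compact metric space, T : X → X a continuous map, f : X → ℝ continuous, ε, β, δ > 0 and N_δ ∈ ℕ. Then for all m, n ∈ ℕ, Cov_{m+n,ε}(β,δ) ≤ Cov_{m,ε}(β,δ) · Cov_{n,ε}(β,δ); consequently lim_{n→∞} (1/n) log Cov_{n,ε}(β,δ) exists and equals inf_n (1/n) log Cov_{n,ε}(β,δ). -/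
open Filter Metric Set Topology

variable {X : Type*}

def FKChain [MetricSpace X] (T : X → X) (α δ : ℝ) (n : ℕ) (x : ℕ → X) : Prop :=
  ∃ k : ℕ, (1 - δ) * (n : ℝ) < (k : ℝ) ∧ k ≤ n ∧
    ∃ i j : ℕ → ℕ,
      StrictMonoOn i (Set.Iio k) ∧ StrictMonoOn j (Set.Iio k) ∧
      (∀ t < k, i t < n ∧ j t < n) ∧
      (∀ t, t + 1 < k → dist (T^[j (t + 1) - j t] (x (i t))) (x (i (t + 1))) ≤ α)

def FKPO [MetricSpace X] (T : X → X) (α δ : ℝ) (N : ℕ) : Set (ℕ → X) :=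
  { x | ∃ s : ℕ → ℕ, StrictMono s ∧ s 0 ≤ N ∧ (∀ i, s (i + 1) - s i ≤ N) ∧
      ∀ m n : ℕ, n < m → FKChain T α δ (s m - s n) (fun t => x (s n + t)) }

noncomputable def dTilde [MetricSpace X] (x y : ℕ → X) : ℝ :=
  ∑' i : ℕ, dist (x i) (y i) / 2 ^ i

def covElem [MetricSpace X] (n : ℕ) (ε : ℝ) (c : ℕ → ℕ → X) : Set (ℕ → X) :=
  { z : ℕ → X | ∀ i < n, dTilde (c i) (fun t => z (i + t)) < ε }

noncomputable def Cov [MetricSpace X] (T : X → X) (f : X → ℝ) (n : ℕ) (ε β δ : ℝ)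
    (N : ℕ) : ℝ :=
  sInf { r : ℝ | ∃ C : Finset (ℕ → ℕ → X),
      (FKPO T β δ N ⊆ ⋃ c ∈ C, covElem n ε c) ∧
      r = ∑ c ∈ C, sSup ((fun z : ℕ → X =>
            Real.exp (∑ i ∈ Finset.range n, f (z i))) '' covElem n ε c) }

theorem FKPO_shift [MetricSpace X] {T : X → X} {α δ : ℝ} {N : ℕ} {x : ℕ → X}
    (hx : x ∈ FKPO T α δ N) (m : ℕ) : (fun t => x (m + t)) ∈ FKPO T α δ N := by
  classical
  obtain ⟨s, hs, hs0, hgap, hchain⟩ := hx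
  have hex : ∃ i, m ≤ s i := ⟨m, hs.le_apply⟩
  obtain ⟨i₀, hi₀, hmin⟩ : ∃ i₀, m ≤ s i₀ ∧ ∀ i < i₀, s i < m :=
    ⟨Nat.find hex, Nat.find_spec hex, fun i hi => not_le.1 (Nat.find_min hex hi)⟩
  have hle : ∀ i, m ≤ s (i₀ + i) := fun i => hi₀.trans (hs.monotone (Nat.le_add_right _ _))
  refine ⟨fun i => s (i₀ + i) - m, fun a b hab => ?_, ?_, fun i => ?_, fun a b hab => ?_⟩
  · have h1 : s (i₀ + a) < s (i₀ + b) := hs (by omega)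
    have h2 := hle a
    simp only
    omega
  · rcases i₀ with _ | k
    · simp only [Nat.add_zero]
      omega
    · have h1 := hgap k
      have h2 := hmin k (Nat.lt_succ_self k)
      simp only [Nat.add_zero]
      omega
  · have h1 := hgap (i₀ + i)
    have h2 := hle i
    have h3 : i₀ + (i + 1) = i₀ + i + 1 := by omega
    simp only [h3]
    omega
  · have h := hchain (i₀ + a) (i₀ + b) (by omega)
    have ha := hle a
    have hb := hle b
    have h1 : s (i₀ + a) - m - (s (i₀ + b) - m) = s (i₀ + a) - s (i₀ + b) := by omega
    have h2 : ∀ t, m + (s (i₀ + b) - m + t) = s (i₀ + b) + t := by omega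
    simp only [h1, h2]
    exact h

theorem dTilde_self [MetricSpace X] (x : ℕ → X) : dTilde x x = 0 := by
  simp [dTilde]

theorem continuous_dTilde_right [MetricSpace X] [CompactSpace X] (x : ℕ → X) :
    Continuous (dTilde x) := by
  have hb : ∀ a b : X, dist a b ≤ diam (univ : Set X) := fun a b =>
    dist_le_diam_of_mem isCompact_univ.isBounded (mem_univ a) (mem_univ b)
  refine continuous_tsum (u := fun i : ℕ => diam (univ : Set X) / 2 ^ i)
    (fun i => by fun_prop) ?_ fun i y => ?_
  · simpa [div_eq_mul_inv] using summable_geometric_two.mul_left (diam (univ : Set X))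
  · rw [Real.norm_of_nonneg (by positivity)]
    gcongr
    exact hb _ _

theorem isOpen_covElem [MetricSpace X] [CompactSpace X] (n : ℕ) (ε : ℝ) (c : ℕ → ℕ → X) :
    IsOpen (covElem n ε c) := by
  have : covElem n ε c =
      ⋂ i ∈ Finset.range n, {z : ℕ → X | dTilde (c i) (fun t => z (i + t)) < ε} := by
    ext z
    simp [covElem]
  rw [this]
  refine isOpen_biInter_finset fun i _ => isOpen_lt ?_ continuous_const
  exact (continuous_dTilde_right (c i)).comp (by fun_prop)

theorem exists_finset_covElem_cover [MetricSpace X] [CompactSpace X] (n : ℕ) {ε : ℝ}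
    (hε : 0 < ε) : ∃ C : Finset (ℕ → ℕ → X), univ ⊆ ⋃ c ∈ C, covElem n ε c := by
  refine isCompact_univ.elim_finite_subcover (covElem n ε) (isOpen_covElem n ε) fun z _ => ?_
  refine mem_iUnion.2 ⟨fun i t => z (i + t), fun i _ => ?_⟩
  rwa [dTilde_self]

/-- The supremum of the exponential of the `n`-th Birkhoff sum over an element of the cover. -/
noncomputable def covWeight [MetricSpace X] (f : X → ℝ) (n : ℕ) (ε : ℝ) (c : ℕ → ℕ → X) : ℝ :=
  sSup ((fun z : ℕ → X => Real.exp (∑ i ∈ Finset.range n, f (z i))) '' covElem n ε c)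

theorem covWeight_nonneg [MetricSpace X] (f : X → ℝ) (n : ℕ) (ε : ℝ) (c : ℕ → ℕ → X) :
    0 ≤ covWeight f n ε c :=
  Real.sSup_nonneg (by rintro _ ⟨z, -, rfl⟩; exact (Real.exp_pos _).le)

theorem exp_sum_le_covWeight [MetricSpace X] {f : X → ℝ} {M : ℝ} (hM : ∀ x, |f x| ≤ M) {n : ℕ}
    {ε : ℝ} {c : ℕ → ℕ → X} {z : ℕ → X} (hz : z ∈ covElem n ε c) :
    Real.exp (∑ i ∈ Finset.range n, f (z i)) ≤ covWeight f n ε c := by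
  refine le_csSup ⟨Real.exp (∑ _i ∈ Finset.range n, M), ?_⟩ (mem_image_of_mem _ hz)
  rintro _ ⟨w, -, rfl⟩
  exact Real.exp_le_exp.2 (Finset.sum_le_sum fun i _ => (le_abs_self _).trans (hM _))

/-- The total weights of the finite covers over which `Cov` is the infimum. -/
def coverWeights [MetricSpace X] (T : X → X) (f : X → ℝ) (n : ℕ) (ε β δ : ℝ) (N : ℕ) : Set ℝ :=
  { r : ℝ | ∃ C : Finset (ℕ → ℕ → X), (FKPO T β δ N ⊆ ⋃ c ∈ C, covElem n ε c) ∧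
      r = ∑ c ∈ C, covWeight f n ε c }

theorem nonneg_of_mem_coverWeights [MetricSpace X] {T : X → X} {f : X → ℝ} {n : ℕ} {ε β δ : ℝ}
    {N : ℕ} {r : ℝ} (hr : r ∈ coverWeights T f n ε β δ N) : 0 ≤ r := by
  obtain ⟨C, -, rfl⟩ := hr
  exact Finset.sum_nonneg fun c _ => covWeight_nonneg f n ε c

theorem Cov_le_of_mem_coverWeights [MetricSpace X] {T : X → X} {f : X → ℝ} {n : ℕ} {ε β δ : ℝ}
    {N : ℕ} {r : ℝ} (hr : r ∈ coverWeights T f n ε β δ N) : Cov T f n ε β δ N ≤ r :=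
  csInf_le ⟨0, fun _ h => nonneg_of_mem_coverWeights h⟩ hr

theorem coverWeights_nonempty [MetricSpace X] [CompactSpace X] (T : X → X) (f : X → ℝ) (n : ℕ)
    {ε : ℝ} (hε : 0 < ε) (β δ : ℝ) (N : ℕ) : (coverWeights T f n ε β δ N).Nonempty := by
  obtain ⟨C, hC⟩ := exists_finset_covElem_cover (X := X) n hε
  exact ⟨_, C, (subset_univ _).trans hC, rfl⟩

/-- Follow the centres `c` for `m` steps and the centres `c'` afterwards. -/
def concatCenters (m : ℕ) (c c' : ℕ → ℕ → X) : ℕ → ℕ → X :=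
  fun i => if i < m then c i else c' (i - m)

theorem mem_covElem_concatCenters [MetricSpace X] {m n : ℕ} {ε : ℝ} {c c' : ℕ → ℕ → X}
    {z : ℕ → X} : z ∈ covElem (m + n) ε (concatCenters m c c') ↔
      z ∈ covElem m ε c ∧ (fun t => z (m + t)) ∈ covElem n ε c' := by
  simp only [covElem, concatCenters, mem_ofPred_eq]
  constructor
  · intro h
    refine ⟨fun i hi => ?_, fun i hi => ?_⟩
    · simpa [hi] using h i (by omega)
    · simpa [add_assoc] using h (m + i) (by omega)
  · rintro ⟨h₁, h₂⟩ i hi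
    split_ifs with him
    · exact h₁ i him
    · have h := h₂ (i - m) (by omega)
      have h3 : ∀ t, m + (i - m + t) = i + t := by omega
      simpa only [h3] using h

theorem covWeight_concatCenters_le [MetricSpace X] {f : X → ℝ} {M : ℝ} (hM : ∀ x, |f x| ≤ M)
    (m n : ℕ) (ε : ℝ) (c c' : ℕ → ℕ → X) :
    covWeight f (m + n) ε (concatCenters m c c') ≤ covWeight f m ε c * covWeight f n ε c' := by
  refine Real.sSup_le ?_ (mul_nonneg (covWeight_nonneg _ _ _ _) (covWeight_nonneg _ _ _ _))
  rintro _ ⟨z, hz, rfl⟩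
  obtain ⟨h₁, h₂⟩ := mem_covElem_concatCenters.1 hz
  simp only [Finset.sum_range_add, Real.exp_add]
  exact mul_le_mul (exp_sum_le_covWeight hM h₁) (exp_sum_le_covWeight hM h₂) (Real.exp_pos _).le
    (covWeight_nonneg _ _ _ _)

theorem Cov_add_le_mul_of_mem_coverWeights [MetricSpace X] {T : X → X} {f : X → ℝ} {M : ℝ}
    (hM : ∀ x, |f x| ≤ M) {m n : ℕ} {ε β δ : ℝ} {N : ℕ} {a b : ℝ}
    (ha : a ∈ coverWeights T f m ε β δ N) (hb : b ∈ coverWeights T f n ε β δ N) :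
    Cov T f (m + n) ε β δ N ≤ a * b := by
  classical
  obtain ⟨C, hC, rfl⟩ := ha
  obtain ⟨D, hD, rfl⟩ := hb
  let g : (ℕ → ℕ → X) × (ℕ → ℕ → X) → ℕ → ℕ → X := fun p => concatCenters m p.1 p.2
  have hcover : FKPO T β δ N ⊆ ⋃ c ∈ (C ×ˢ D).image g, covElem (m + n) ε c := by
    intro x hx
    obtain ⟨c, hc, hxc⟩ := mem_iUnion₂.1 (hC hx)
    obtain ⟨c', hc', hxc'⟩ := mem_iUnion₂.1 (hD (FKPO_shift hx m))
    exact mem_iUnion₂.2 ⟨g (c, c'), Finset.mem_image_of_mem g (Finset.mk_mem_product hc hc'),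
      mem_covElem_concatCenters.2 ⟨hxc, hxc'⟩⟩
  calc Cov T f (m + n) ε β δ N
      ≤ ∑ c ∈ (C ×ˢ D).image g, covWeight f (m + n) ε c :=
        Cov_le_of_mem_coverWeights ⟨_, hcover, rfl⟩
    _ ≤ ∑ p ∈ C ×ˢ D, covWeight f (m + n) ε (g p) :=
        Finset.sum_image_le_of_nonneg fun _ _ => covWeight_nonneg _ _ _ _
    _ ≤ ∑ p ∈ C ×ˢ D, covWeight f m ε p.1 * covWeight f n ε p.2 :=
        Finset.sum_le_sum fun p _ => covWeight_concatCenters_le hM m n ε p.1 p.2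
    _ = (∑ c ∈ C, covWeight f m ε c) * ∑ c ∈ D, covWeight f n ε c := by
        rw [Finset.sum_mul_sum, Finset.sum_product]

theorem le_mul_csInf {r a : ℝ} {S : Set ℝ} (hS : S.Nonempty) (ha : 0 ≤ a)
    (h : ∀ b ∈ S, r ≤ a * b) : r ≤ a * sInf S := by
  rw [← smul_eq_mul, ← Real.sInf_smul_of_nonneg ha]
  refine le_csInf (hS.image _) ?_
  rintro _ ⟨b, hb, rfl⟩
  exact h b hb

theorem Cov_nonneg [MetricSpace X] (T : X → X) (f : X → ℝ) (n : ℕ) (ε β δ : ℝ) (N : ℕ) :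
    0 ≤ Cov T f n ε β δ N :=
  Real.sInf_nonneg fun _ h => nonneg_of_mem_coverWeights h

theorem Cov_add_le_mul [MetricSpace X] [CompactSpace X] (T : X → X) {f : X → ℝ} {M : ℝ}
    (hM : ∀ x, |f x| ≤ M) (m n : ℕ) {ε : ℝ} (hε : 0 < ε) (β δ : ℝ) (N : ℕ) :
    Cov T f (m + n) ε β δ N ≤ Cov T f m ε β δ N * Cov T f n ε β δ N := by
  refine le_mul_csInf (coverWeights_nonempty T f n hε β δ N) (Cov_nonneg _ _ _ _ _ _ _)
    fun b hb => ?_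
  rw [mul_comm]
  refine le_mul_csInf (coverWeights_nonempty T f m hε β δ N) (nonneg_of_mem_coverWeights hb)
    fun a ha => ?_
  rw [mul_comm]
  exact Cov_add_le_mul_of_mem_coverWeights hM ha hb

theorem exp_neg_mul_le_Cov [MetricSpace X] [CompactSpace X] {T : X → X} {f : X → ℝ} {M : ℝ}
    (hM : ∀ x, |f x| ≤ M) (n : ℕ) {ε : ℝ} (hε : 0 < ε) {β δ : ℝ} {N : ℕ}
    (hne : (FKPO T β δ N).Nonempty) : Real.exp (-(n * M)) ≤ Cov T f n ε β δ N := by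
  refine le_csInf (coverWeights_nonempty T f n hε β δ N) ?_
  rintro _ ⟨C, hC, rfl⟩
  obtain ⟨x, hx⟩ := hne
  obtain ⟨c, hc, hxc⟩ := mem_iUnion₂.1 (hC hx)
  calc Real.exp (-(n * M)) = Real.exp (∑ _i ∈ Finset.range n, -M) := by simp
    _ ≤ Real.exp (∑ i ∈ Finset.range n, f (x i)) :=
        Real.exp_le_exp.2 (Finset.sum_le_sum fun i _ => (abs_le.1 (hM _)).1)
    _ ≤ covWeight f n ε c := exp_sum_le_covWeight hM hxc
    _ ≤ ∑ c ∈ C, covWeight f n ε c :=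
        Finset.single_le_sum (f := covWeight f n ε) (fun c _ => covWeight_nonneg f n ε c) hc

theorem Cov_eq_zero_of_FKPO_eq_empty [MetricSpace X] {T : X → X} {β δ : ℝ} {N : ℕ}
    (h : FKPO T β δ N = ∅) (f : X → ℝ) (n : ℕ) (ε : ℝ) : Cov T f n ε β δ N = 0 :=
  le_antisymm (Cov_le_of_mem_coverWeights ⟨∅, by simp [h], by simp⟩) (Cov_nonneg _ _ _ _ _ _ _)

/-- `Cov` is submultiplicative in `n`; consequently
`lim (1/n) log Cov_{n,ε}(β,δ)` exists and equals `inf_{n ≥ 1} (1/n) log Cov_{n,ε}(β,δ)`. -/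
theorem Cov_submultiplicative_and_limit [MetricSpace X] [CompactSpace X] (T : X → X)
    (hT : Continuous T) (f : X → ℝ) (hf : Continuous f) (ε β δ : ℝ)
    (hε : 0 < ε) (hβ : 0 < β) (hδ : 0 < δ) (N : ℕ) :
    (∀ m n : ℕ, Cov T f (m + n) ε β δ N ≤ Cov T f m ε β δ N * Cov T f n ε β δ N) ∧
      Tendsto (fun n : ℕ => Real.log (Cov T f n ε β δ N) / n) atTop
        (nhds (sInf { r : ℝ | ∃ n : ℕ, 0 < n ∧
          r = Real.log (Cov T f n ε β δ N) / n })) := by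
  obtain ⟨M, hM⟩ : ∃ M, ∀ x, |f x| ≤ M := by
    obtain ⟨M, hM⟩ := isCompact_univ.exists_bound_of_continuousOn hf.continuousOn
    exact ⟨M, fun x => hM x (mem_univ x)⟩
  have hmul : ∀ m n : ℕ, Cov T f (m + n) ε β δ N ≤ Cov T f m ε β δ N * Cov T f n ε β δ N :=
    fun m n => Cov_add_le_mul T hM m n hε β δ N
  refine ⟨hmul, ?_⟩
  rcases (FKPO T β δ N).eq_empty_or_nonempty with he | hne
  · have hset : { r : ℝ | ∃ n : ℕ, 0 < n ∧ r = 0 } = {0} :=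
      Set.ext fun r => ⟨fun ⟨_, _, h⟩ => h, fun h => ⟨1, one_pos, h⟩⟩
    simp only [Cov_eq_zero_of_FKPO_eq_empty he, Real.log_zero, zero_div, hset, csInf_singleton]
    exact tendsto_const_nhds
  · have hexp := fun n => exp_neg_mul_le_Cov hM n hε hne
    have hpos : ∀ n, 0 < Cov T f n ε β δ N := fun n => (Real.exp_pos _).trans_le (hexp n)
    have hsub : Subadditive fun n => Real.log (Cov T f n ε β δ N) := fun m n => by
      rw [← Real.log_mul (hpos m).ne' (hpos n).ne']
      exact Real.log_le_log (hpos _) (hmul m n)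
    have hM0 : 0 ≤ M := by
      obtain ⟨x, -⟩ := hne
      exact (abs_nonneg _).trans (hM (x 0))
    have hbdd : BddBelow (range fun n : ℕ => Real.log (Cov T f n ε β δ N) / n) := by
      refine ⟨-M, ?_⟩
      rintro _ ⟨n, rfl⟩
      rcases n.eq_zero_or_pos with rfl | hn
      · simpa using hM0
      · have h := (Real.le_log_iff_exp_le (hpos n)).2 (hexp n)
        have hn' : (0 : ℝ) < n := Nat.cast_pos.2 hn
        rw [le_div_iff₀ hn']
        linarith
    convert hsub.tendsto_lim hbdd using 2
    rw [Subadditive.lim]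
    congr 1
    ext r
    simp [Nat.one_le_iff_ne_zero, Nat.pos_iff_ne_zero, eq_comm]
end

section
/- Let (X,d) be a compact metric space, T : X → X a continuous map and M ∈ ℕ. Suppose 0 < δ_0 < δ_1 < … < δ_{2M} are such that for every k = 0,1,…,2M−1, d(x,y) < δ_k implies d(T^ix,T^iy) < δ_{k+1} for all i = 0,…,2M−1, and let 0 < α < min{δ_0, min_{0≤k≤2M−1}(δ_{k+1}−δ_k)}. If points x_{i_1}, …, x_{i_k} ∈ X (k ≤ M) and integers 0 ≤ j_1 < j_2 < … < j_k ≤ M−1 satisfy d(T^{j_{t+1}−j_t}(x_{i_t}), x_{i_{t+1}}) ≤ α for t = 1,…,k−1, then for every t = 2,…,k, d(T^{j_t−j_1}(x_{i_1}), x_{i_t}) < δ_{2(t−2)}; in particular d(T^{j_t−j_1}(x_{i_1}), x_{i_t}) < δ_{2M}. -/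
open Filter Metric Set Topology

variable {X : Type*}

/-- the key induction step: points linked by an α-chain with time gaps
`j (t+1) − j t` shadow a genuine orbit segment of the initial point up to error
`δs (2*(t−1))` (0-indexed), and in particular up to error `δs (2*M)`. -/
theorem chain_shadowing_induction [MetricSpace X] [CompactSpace X] (T : X → X)
    (hT : Continuous T) (M : ℕ) (δs : ℕ → ℝ) (hδ0 : 0 < δs 0)
    (hδmono : ∀ k l : ℕ, k < l → l ≤ 2 * M → δs k < δs l)
    (hcont : ∀ k < 2 * M, ∀ x y : X, dist x y < δs k →
      ∀ i < 2 * M, dist (T^[i] x) (T^[i] y) < δs (k + 1))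
    (α : ℝ) (hα : 0 < α) (hαδ : α < δs 0)
    (hαgap : ∀ k < 2 * M, α < δs (k + 1) - δs k)
    (k : ℕ) (hk : k ≤ M)
    (j : ℕ → ℕ) (hjmono : StrictMonoOn j (Set.Iio k)) (hjlt : ∀ t < k, j t < M)
    (p : ℕ → X)
    (hchain : ∀ t, t + 1 < k → dist (T^[j (t + 1) - j t] (p t)) (p (t + 1)) ≤ α) :
    ∀ t, 0 < t → t < k →
      dist (T^[j t - j 0] (p 0)) (p t) < δs (2 * (t - 1)) ∧
      dist (T^[j t - j 0] (p 0)) (p t) < δs (2 * M) := by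
  have orbit_close : ∀ t, t + 1 < k →
      dist (T^[j (t + 1) - j 0] (p 0)) (p (t + 1)) < δs (2 * t) := by
    intro t
    induction t with
    | zero => exact fun h => (hchain 0 h).trans_lt hαδ
    | succ t ih =>
      intro ht
      have hgap : j (t + 1) < j (t + 2) :=
        hjmono (Set.mem_Iio.2 (by omega)) (Set.mem_Iio.2 ht) (by omega)
      have hstart : j 0 < j (t + 1) :=
        hjmono (Set.mem_Iio.2 (by omega)) (Set.mem_Iio.2 (by omega)) (by omega)
      have hlt := hjlt (t + 2) ht
      have himage := hcont (2 * t) (by omega) _ _ (ih (by omega))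
        (j (t + 2) - j (t + 1)) (by omega)
      rw [← Function.iterate_add_apply,
        show j (t + 2) - j (t + 1) + (j (t + 1) - j 0) = j (t + 2) - j 0 by omega] at himage
      have hjump := hchain (t + 1) ht
      have hroom := hαgap (2 * t + 1) (by omega)
      have htri := dist_triangle (T^[j (t + 2) - j 0] (p 0))
        (T^[j (t + 2) - j (t + 1)] (p (t + 1))) (p (t + 2))
      change dist _ (p (t + 2)) < δs (2 * t + 1 + 1)
      linarith
  intro t ht htk
  obtain ⟨t, rfl⟩ := Nat.exists_eq_succ_of_ne_zero ht.ne'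
  have h := orbit_close t htk
  exact ⟨h, h.trans (hδmono _ _ (by omega) le_rfl)⟩
end
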